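/- arXiv:2110.01081 — 2 statements merged into one kernel-verified Lean document; each statement's English description precedes it below -/
import Mathlib

section
/- Let α be a zero-sum-free sequence of length n over an abelian group, and suppose that the set Σ(α) of all subsequence sums of α has at most m elements, where m < 2n. Then for every integer r ≥ 1, there is a group element that appears in α with multiplicity μ satisfying μ ≥ (2/r)·(n − (m−1)/(r+1)); equivalently, the maximum multiplicity μ of a term of α satisfies r(r+1)·μ ≥ 2·((r+1)·n − m + 1) for every integer r ≥ 1. -/
/-- The set of all subsequence sums of a list (including the sum 0 of the empty
subsequence). -/
def subSums {G : Type*} [AddCommMonoid G] [DecidableEq G] (l : List G) : Finset G :=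
  (l.sublists.map List.sum).toFinset

/-- A sequence is zero-sum-free if no nonempty subsequence sums to zero. -/
def ZeroSumFree {G : Type*} [AddCommMonoid G] (l : List G) : Prop :=
  ∀ t : List G, t.Sublist l → t ≠ [] → t.sum ≠ 0

section CommMonoid

variable {G : Type*} [AddCommMonoid G]

theorem ZeroSumFree.perm {l l' : List G} (hl : ZeroSumFree l) (h : l.Perm l') :
    ZeroSumFree l' := by
  intro t ht hne
  obtain ⟨t', ht', hs⟩ := ht.subperm.trans h.symm.subperm
  rw [← ht'.sum_eq]
  refine hl t' hs ?_
  rintro rfl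
  exact hne (List.nil_perm.1 ht')

theorem ZeroSumFree.of_cons {a : G} {l : List G} (h : ZeroSumFree (a :: l)) :
    ZeroSumFree l :=
  fun t ht => h t (ht.cons a)

variable [DecidableEq G]

theorem mem_subSums {l : List G} {x : G} :
    x ∈ subSums l ↔ ∃ t : List G, t.Sublist l ∧ t.sum = x := by
  simp [subSums]

theorem subSums_cons (a : G) (l : List G) :
    subSums (a :: l) = subSums l ∪ (subSums l).image (a + ·) := by
  ext x
  simp only [Finset.mem_union, Finset.mem_image, mem_subSums, List.sublist_cons_iff]
  constructor
  · rintro ⟨t, ht | ⟨r, rfl, hr⟩, rfl⟩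
    · exact Or.inl ⟨t, ht, rfl⟩
    · exact Or.inr ⟨_, ⟨r, hr, rfl⟩, by simp⟩
  · rintro (⟨t, ht, rfl⟩ | ⟨_, ⟨r, hr, rfl⟩, rfl⟩)
    · exact ⟨t, Or.inl ht, rfl⟩
    · exact ⟨a :: r, Or.inr ⟨r, rfl, hr⟩, by simp⟩

theorem subSums_perm {l l' : List G} (h : l.Perm l') : subSums l = subSums l' := by
  ext x
  simp only [mem_subSums]
  constructor
  · rintro ⟨t, ht, rfl⟩
    obtain ⟨t', ht', hs⟩ := ht.subperm.trans h.subperm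
    exact ⟨t', hs, ht'.sum_eq⟩
  · rintro ⟨t, ht, rfl⟩
    obtain ⟨t', ht', hs⟩ := ht.subperm.trans h.symm.subperm
    exact ⟨t', hs, ht'.sum_eq⟩

theorem zero_mem_subSums (l : List G) : 0 ∈ subSums l :=
  mem_subSums.2 ⟨[], List.nil_sublist l, rfl⟩

theorem sum_mem_subSums (l : List G) : l.sum ∈ subSums l :=
  mem_subSums.2 ⟨l, List.Sublist.refl l, rfl⟩

theorem mem_subSums_of_mem {l : List G} {a : G} (h : a ∈ l) : a ∈ subSums l :=
  mem_subSums.2 ⟨[a], List.singleton_sublist.2 h, by simp⟩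

theorem ZeroSumFree.add_ne_zero {a x : G} {l : List G} (h : ZeroSumFree (a :: l))
    (hx : x ∈ subSums l) : a + x ≠ 0 := by
  obtain ⟨t, ht, rfl⟩ := mem_subSums.1 hx
  simpa using h (a :: t) (ht.cons_cons a) (by simp)

theorem subSums_map_nsmul_subset (g : G) (xs : List ℕ) :
    subSums (xs.map (· • g)) ⊆ (Finset.range (xs.sum + 1)).image (· • g) := by
  intro x hx
  obtain ⟨t, ht, rfl⟩ := mem_subSums.1 hx
  obtain ⟨ys, hys, rfl⟩ := List.sublist_map_iff.1 ht
  refine Finset.mem_image.2 ⟨ys.sum, ?_, ?_⟩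
  · exact Finset.mem_range.2 (Nat.lt_succ_of_le (hys.sum_le_sum fun _ _ => Nat.zero_le _))
  · clear ht hx hys
    induction ys with
    | nil => simp
    | cons y ys ih => simp only [List.sum_cons, List.map_cons, add_nsmul, ih]

end CommMonoid

section CommGroup

variable {G : Type*} [AddCommGroup G] [DecidableEq G]

theorem sum_sub_mem_subSums {l : List G} {x : G} (hx : x ∈ subSums l) :
    l.sum - x ∈ subSums l := by
  induction l generalizing x with
  | nil => simpa [subSums, eq_comm] using hx
  | cons a l ih =>
    rw [subSums_cons, Finset.mem_union, Finset.mem_image] at hx ⊢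
    rcases hx with hx | ⟨y, hy, rfl⟩
    · exact Or.inr ⟨_, ih hx, by rw [List.sum_cons]; abel⟩
    · refine Or.inl ?_
      have h : (a :: l).sum - (a + y) = l.sum - y := by rw [List.sum_cons]; abel
      exact h ▸ ih hy

theorem ZeroSumFree.sum_notMem {a : G} {l : List G} (h : ZeroSumFree (a :: l)) :
    (a :: l).sum ∉ subSums l := by
  intro hs
  refine h.add_ne_zero (sum_sub_mem_subSums hs) ?_
  rw [List.sum_cons]
  abel

theorem ZeroSumFree.length_lt_card {l : List G} (h : ZeroSumFree l) :
    l.length < (subSums l).card := by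
  induction l with
  | nil => exact Finset.card_pos.2 ⟨0, zero_mem_subSums _⟩
  | cons a l ih =>
    have hlt : (subSums l).card < (subSums (a :: l)).card := by
      refine Finset.card_lt_card ((Finset.ssubset_iff_of_subset ?_).2
        ⟨_, sum_mem_subSums (a :: l), h.sum_notMem⟩)
      rw [subSums_cons]
      exact Finset.subset_union_left
    have := ih h.of_cons
    rw [List.length_cons]
    omega

theorem ZeroSumFree.subSums_eq_erase_sum {a : G} {l : List G} (h : ZeroSumFree (a :: l))
    (hc : (subSums (a :: l)).card ≤ (subSums l).card + 1) :
    subSums l = (subSums (a :: l)).erase (a :: l).sum := by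
  apply Finset.eq_of_subset_of_card_le
  · intro x hx
    refine Finset.mem_erase.2 ⟨fun hs => h.sum_notMem (hs ▸ hx), ?_⟩
    rw [subSums_cons]
    exact Finset.mem_union_left _ hx
  · rw [Finset.card_erase_of_mem (sum_mem_subSums _)]
    omega

theorem ZeroSumFree.image_subSums_eq_erase_zero {a : G} {l : List G}
    (h : ZeroSumFree (a :: l))
    (hc : (subSums (a :: l)).card ≤ (subSums l).card + 1) :
    (subSums l).image (a + ·) = (subSums (a :: l)).erase 0 := by
  apply Finset.eq_of_subset_of_card_le
  · intro x hx
    refine Finset.mem_erase.2 ⟨?_, ?_⟩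
    · obtain ⟨y, hy, rfl⟩ := Finset.mem_image.1 hx
      exact h.add_ne_zero hy
    · rw [subSums_cons]
      exact Finset.mem_union_right _ hx
  · rw [Finset.card_erase_of_mem (zero_mem_subSums _),
      Finset.card_image_of_injective _ (add_right_injective a)]
    omega

/-- If deleting any single term of a zero-sum-free sequence loses at most one subsequence sum,
then all terms of the sequence are equal. -/
theorem ZeroSumFree.eq_of_card_le_card_erase {l : List G} (h : ZeroSumFree l)
    (hc : ∀ a ∈ l, (subSums l).card ≤ (subSums (l.erase a)).card + 1)
    {a b : G} (ha : a ∈ l) (hb : b ∈ l) : a = b := by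
  have key : ∀ c ∈ l, ZeroSumFree (c :: l.erase c) ∧
      subSums (l.erase c) = (subSums l).erase l.sum ∧
      (subSums (l.erase c)).image (c + ·) = (subSums l).erase 0 := by
    intro c hcl
    have hp := List.perm_cons_erase hcl
    have hz := h.perm hp
    have hcc := hc c hcl
    rw [subSums_perm hp] at hcc
    refine ⟨hz, ?_, ?_⟩
    · rw [hz.subSums_eq_erase_sum hcc, ← subSums_perm hp, ← hp.sum_eq]
    · rw [hz.image_subSums_eq_erase_zero hcc, ← subSums_perm hp]
  obtain ⟨hza, hsa, hia⟩ := key a ha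
  obtain ⟨hzb, hsb, hib⟩ := key b hb
  by_contra hab
  have ha0 : a ≠ 0 := by simpa using hza.add_ne_zero (zero_mem_subSums _)
  have hmem : a ∈ (subSums (l.erase b)).image (b + ·) := by
    rw [hib]
    exact Finset.mem_erase.2 ⟨ha0, mem_subSums_of_mem ha⟩
  obtain ⟨d, hd, hda⟩ := Finset.mem_image.1 hmem
  have hd0 : d ≠ 0 := by
    rintro rfl
    exact hab (by simpa using hda.symm)
  have hmem' : d ∈ (subSums (l.erase a)).image (a + ·) := by
    rw [hia]
    rw [hsb] at hd
    exact Finset.mem_erase.2 ⟨hd0, Finset.mem_of_mem_erase hd⟩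
  obtain ⟨e, he, hed⟩ := Finset.mem_image.1 hmem'
  rw [hsa, ← hsb] at he
  refine hzb.add_ne_zero he ?_
  have h2 : a + (b + e) = a := by
    calc a + (b + e) = b + (a + e) := by abel
      _ = a := by rw [hed, hda]
  exact add_eq_left.1 h2

/-- A zero-sum-free sequence whose first term is `a` and whose remaining terms are positive
multiples of `g` filling an initial segment again consists of such multiples of `g`. -/
theorem ZeroSumFree.exists_nsmul_cons {a g : G} {xs : List ℕ}
    (h : ZeroSumFree (a :: xs.map (· • g)))
    (hxs : xs.sum + 1 ≤ (subSums (xs.map (· • g))).card)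
    (hc : (subSums (a :: xs.map (· • g))).card < 2 * (xs.sum + 1)) :
    ∃ t : ℕ, 1 ≤ t ∧ a = t • g ∧
      t + xs.sum + 1 ≤ (subSums (a :: xs.map (· • g))).card := by
  set s := xs.sum
  have hB : subSums (xs.map (· • g)) = (Finset.range (s + 1)).image (· • g) := by
    refine Finset.eq_of_subset_of_card_le (subSums_map_nsmul_subset g xs) ?_
    exact Finset.card_image_le.trans (by simpa using hxs)
  have hinj : Set.InjOn (· • g) (Finset.range (s + 1) : Set ℕ) := by
    refine Finset.card_image_iff.1 (le_antisymm Finset.card_image_le ?_)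
    rw [← hB]
    simpa using hxs
  have hcard : (subSums (xs.map (· • g))).card = s + 1 := by
    rw [hB, Finset.card_image_of_injOn hinj, Finset.card_range]
  have hne : ∀ j ≤ s, a + j • g ≠ 0 := fun j hj => h.add_ne_zero (by
    rw [hB]
    exact Finset.mem_image.2 ⟨j, Finset.mem_range.2 (by omega), rfl⟩)
  have hnd : ¬ Disjoint (subSums (xs.map (· • g)))
      ((subSums (xs.map (· • g))).image (a + ·)) := by
    intro hd
    rw [subSums_cons, Finset.card_union_of_disjoint hd,
      Finset.card_image_of_injective _ (add_right_injective a), hcard] at hc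
    omega
  obtain ⟨x, hx, hx'⟩ := Finset.not_disjoint_iff.1 hnd
  obtain ⟨y, hy, hyx⟩ := Finset.mem_image.1 hx'
  rw [hB] at hx hy
  obtain ⟨i, hi, rfl⟩ := Finset.mem_image.1 hx
  obtain ⟨j, hj, rfl⟩ := Finset.mem_image.1 hy
  simp only [Finset.mem_range] at hi hj
  have hji : j < i := by
    by_contra hij
    obtain ⟨k, rfl⟩ := Nat.exists_eq_add_of_le (not_lt.1 hij)
    refine hne k (by omega) ?_
    rw [add_nsmul] at hyx
    have h2 : i • g + (a + k • g) = i • g := by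
      calc i • g + (a + k • g) = a + (i • g + k • g) := by abel
        _ = i • g := hyx
    exact add_eq_left.1 h2
  obtain ⟨t, rfl⟩ := Nat.exists_eq_add_of_le hji.le
  have hat : a = t • g := by
    rw [add_nsmul, add_comm] at hyx
    exact add_left_cancel hyx
  refine ⟨t, by omega, hat, ?_⟩
  have hsub : (Finset.range (t + s + 1)).image (· • g) ⊆
      subSums (a :: xs.map (· • g)) := by
    intro x hx
    obtain ⟨k, hk, rfl⟩ := Finset.mem_image.1 hx
    rw [Finset.mem_range] at hk
    rw [subSums_cons, hB]
    by_cases hks : k ≤ s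
    · exact Finset.mem_union_left _
        (Finset.mem_image_of_mem _ (Finset.mem_range.2 (by omega)))
    · refine Finset.mem_union_right _ (Finset.mem_image.2 ⟨(k - t) • g,
        Finset.mem_image_of_mem _ (Finset.mem_range.2 (by omega)), ?_⟩)
      rw [hat, ← add_nsmul, Nat.add_sub_cancel' (by omega)]
  have hnz : ∀ d, 1 ≤ d → d ≤ t + s → d • g ≠ 0 := by
    intro d hd1 hd2 hd0
    by_cases hds : d ≤ s
    · have := hinj (x₁ := d) (x₂ := 0) (by simp; omega) (by simp) (by simpa using hd0)
      omega
    · refine hne (d - t) (by omega) ?_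
      rw [hat, ← add_nsmul, Nat.add_sub_cancel' (by omega), hd0]
  have hinj' : Set.InjOn (· • g) (Finset.range (t + s + 1) : Set ℕ) := by
    have aux : ∀ p q : ℕ, p < q → q < t + s + 1 → p • g ≠ q • g := by
      intro p q hpq hq heq
      obtain ⟨d, rfl⟩ := Nat.exists_eq_add_of_le hpq.le
      rw [add_nsmul] at heq
      exact hnz d (by omega) (by omega) (add_eq_left.1 heq.symm)
    intro p hp q hq heq
    simp only [Finset.coe_range, Set.mem_Iio] at hp hq
    rcases lt_trichotomy p q with hlt | rfl | hlt
    · exact absurd heq (aux p q hlt hq)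
    · rfl
    · exact absurd heq.symm (aux q p hlt hp)
  calc t + s + 1 = ((Finset.range (t + s + 1)).image (· • g)).card := by
        rw [Finset.card_image_of_injOn hinj', Finset.card_range]
    _ ≤ _ := Finset.card_le_card hsub

/-- A zero-sum-free sequence with fewer than twice as many subsequence sums as terms consists
of positive multiples of a single element, with coefficients of total at most the number of
nonempty subsequence sums. -/
theorem ZeroSumFree.exists_perm_map_nsmul {l : List G} (h : ZeroSumFree l)
    (hc : (subSums l).card < 2 * l.length) :
    ∃ (g : G) (xs : List ℕ), l.Perm (xs.map (· • g)) ∧ (∀ x ∈ xs, 1 ≤ x) ∧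
      xs.sum + 1 ≤ (subSums l).card := by
  induction hn : l.length generalizing l with
  | zero => omega
  | succ n ih =>
    by_cases hall : ∀ a ∈ l, (subSums l).card ≤ (subSums (l.erase a)).card + 1
    · obtain ⟨a, ha⟩ := List.exists_mem_of_length_pos (l := l) (by omega)
      have hrep : l = List.replicate l.length a :=
        List.eq_replicate_of_mem fun b hb => h.eq_of_card_le_card_erase hall hb ha
      refine ⟨a, List.replicate l.length 1, ?_, by simp, ?_⟩
      · rw [List.map_replicate, one_nsmul, ← hrep]
      · simpa using h.length_lt_card
    · push Not at hall
      obtain ⟨a, ha, hlt⟩ := hall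
      have hp := List.perm_cons_erase ha
      have hlen : (l.erase a).length = n := by rw [List.length_erase_of_mem ha]; omega
      obtain ⟨g, xs, hxp, hpos, hsum⟩ := ih (h.perm hp).of_cons (by omega) hlen
      have hp' : l.Perm (a :: xs.map (· • g)) := hp.trans (hxp.cons a)
      have hxlen : xs.length = n := by rw [← hlen, hxp.length_eq, List.length_map]
      have hle : xs.length ≤ xs.sum := List.length_le_sum_of_one_le xs hpos
      rw [subSums_perm hxp] at hsum
      obtain ⟨t, ht, hat, hts⟩ := (h.perm hp').exists_nsmul_cons hsum (by
        rw [← subSums_perm hp']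
        omega)
      refine ⟨g, t :: xs, ?_, ?_, ?_⟩
      · rw [List.map_cons, ← hat]
        exact hp'
      · exact List.forall_mem_cons.2 ⟨ht, hpos⟩
      · rw [subSums_perm hp', List.sum_cons]
        exact hts

end CommGroup

theorem two_mul_succ_mul_length_le {xs : List ℕ} {M : ℕ} (hpos : ∀ x ∈ xs, 1 ≤ x)
    (hM : ∀ x, xs.count x ≤ M) (r : ℕ) :
    2 * ((r + 1) * xs.length) ≤ r * (r + 1) * M + 2 * xs.sum := by
  have hlen : (r + 1) * xs.length ≤ (xs.map fun x => r + 1 - x).sum + xs.sum := by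
    clear hpos hM
    induction xs with
    | nil => simp
    | cons x xs ih =>
      simp only [List.length_cons, List.map_cons, List.sum_cons, mul_add, mul_one]
      omega
  have htri : ∀ k : ℕ, 2 * ∑ x ∈ Finset.Icc 1 k, (k + 1 - x) = k * (k + 1) := by
    intro k
    have h := Finset.sum_range_id_mul_two (k + 1)
    rw [← Finset.sum_range_reflect, Finset.sum_range_succ] at h
    rw [← Finset.Ico_add_one_right_eq_Icc, Finset.sum_Ico_eq_sum_range]
    simp only [Nat.add_sub_cancel, Nat.sub_self, add_zero] at h ⊢
    rw [mul_comm, mul_comm k, ← h]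
    congr 1
    exact Finset.sum_congr rfl fun i _ => by omega
  have hsum : (xs.map fun x => r + 1 - x).sum ≤ (∑ x ∈ Finset.Icc 1 r, (r + 1 - x)) * M := by
    rw [Finset.sum_list_map_count, Finset.sum_mul]
    calc ∑ x ∈ xs.toFinset, xs.count x • (r + 1 - x)
        ≤ ∑ x ∈ xs.toFinset ∩ Finset.Icc 1 r, xs.count x • (r + 1 - x) := by
          refine (Finset.sum_subset Finset.inter_subset_left fun x hx hx' => ?_).ge
          have h1 := hpos x (List.mem_toFinset.1 hx)
          have h2 : r + 1 - x = 0 := by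
            by_contra hne
            exact hx' (Finset.mem_inter.2 ⟨hx, Finset.mem_Icc.2 ⟨h1, by omega⟩⟩)
          rw [h2, smul_zero]
      _ ≤ ∑ x ∈ Finset.Icc 1 r, xs.count x • (r + 1 - x) :=
          Finset.sum_le_sum_of_subset Finset.inter_subset_right
      _ ≤ ∑ x ∈ Finset.Icc 1 r, (r + 1 - x) * M := by
          refine Finset.sum_le_sum fun x _ => ?_
          rw [smul_eq_mul, mul_comm]
          exact Nat.mul_le_mul_left _ (hM x)
  have := htri r
  nlinarith

/-- **Theorem.** If `α` is a zero-sum-free sequence of length `n` over an abelian group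
with at most `m < 2n` subsequence sums, then for every `r ≥ 1` some group element
appears in `α` with multiplicity `μ` satisfying `r(r+1)·μ ≥ 2((r+1)·n − m + 1)`
(stated in the subtraction-free form `r(r+1)·μ + 2m ≥ 2((r+1)·n + 1)`). -/
theorem high_multiplicity {G : Type*} [AddCommGroup G] [DecidableEq G] (l : List G)
    (m : ℕ) (hzsf : ZeroSumFree l) (hm : (subSums l).card ≤ m)
    (hmn : m < 2 * l.length) :
    ∀ r : ℕ, 1 ≤ r → ∃ g : G,
      2 * ((r + 1) * l.length + 1) ≤ r * (r + 1) * l.count g + 2 * m := by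
  intro r _
  obtain ⟨g, xs, hp, hpos, hsum⟩ := hzsf.exists_perm_map_nsmul (by omega)
  obtain ⟨a, ha⟩ := List.exists_mem_of_length_pos (l := l) (by omega)
  obtain ⟨b, -, hb⟩ := l.toFinset.exists_max_image (l.count ·) ⟨a, List.mem_toFinset.2 ha⟩
  have hmax : ∀ c, l.count c ≤ l.count b := by
    intro c
    by_cases hc : c ∈ l
    · exact hb c (List.mem_toFinset.2 hc)
    · rw [List.count_eq_zero_of_not_mem hc]
      exact Nat.zero_le _
  have hcount : ∀ x, xs.count x ≤ l.count b := fun x =>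
    (List.count_le_count_map (f := (· • g))).trans
      ((hp.count_eq _).ge.trans (hmax (x • g)))
  have hmain := two_mul_succ_mul_length_le hpos hcount r
  have hlen : l.length = xs.length := by rw [hp.length_eq, List.length_map]
  refine ⟨b, ?_⟩
  rw [hlen]
  omega
end

section
/- Let α = (a_1, ..., a_n) be a connected sequence of elements of an abelian group, and let ξ = (x_1, ..., x_n) be the integer sequence associated with α (so that a_k = x_k·a_1 for all k, with 0 ≤ x_k < ord(a_1) whenever a_1 has finite order). If α is zero-sum-free, then all terms of ξ are positive (x_k ≥ 1 for all k), ξ is strongly connected, and moreover x_1 + ... + x_n < ord(a_1) in case a_1 has finite order. -/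
/-- A sequence is connected if each term (after the first) is a difference of two
subsequence sums of the preceding terms: `a_k ∈ Σ(α_{k-1}) - Σ(α_{k-1})` for `k ∈ [2,n]`. -/
def IsConnectedSeq {G : Type*} [AddCommGroup G] [DecidableEq G] (l : List G) : Prop :=
  ∀ i : ℕ, ∀ h : i < l.length, 0 < i →
    ∃ x ∈ subSums (l.take i), ∃ y ∈ subSums (l.take i), l.get ⟨i, h⟩ = x - y

/-- An integer sequence is strongly connected if each term (after the first) is a
subsequence sum of the preceding terms: `x_k ∈ Σ(ξ_{k-1})` for `k ∈ [2,n]`. -/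
def IsStronglyConnected (l : List ℤ) : Prop :=
  ∀ i : ℕ, ∀ h : i < l.length, 0 < i → l.get ⟨i, h⟩ ∈ subSums (l.take i)

theorem mem_subSums_s9 {G : Type*} [AddCommMonoid G] [DecidableEq G] {l : List G} {g : G} :
    g ∈ subSums l ↔ ∃ s : List G, s.Sublist l ∧ s.sum = g := by
  simp [subSums]

theorem sum_map_zsmul {G : Type*} [AddCommGroup G] (a : G) (l : List ℤ) :
    (l.map (fun k => k • a)).sum = l.sum • a := by
  induction l with
  | nil => simp
  | cons k l ih => simp [ih, add_zsmul]

theorem exists_of_mem_subSums_map_zsmul {G : Type*} [AddCommGroup G] [DecidableEq G] {a : G}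
    {l : List ℤ} {g : G} (hg : g ∈ subSums (l.map (fun k => k • a))) :
    ∃ m ∈ subSums l, g = m • a := by
  obtain ⟨s, hs, rfl⟩ := mem_subSums_s9.1 hg
  obtain ⟨r, hr, rfl⟩ := List.sublist_map_iff.1 hs
  exact ⟨r.sum, mem_subSums_s9.2 ⟨r, hr, rfl⟩, sum_map_zsmul a r⟩

theorem subSums_bounds {l : List ℤ} (hl : ∀ k ∈ l, 0 ≤ k) {m : ℤ} (hm : m ∈ subSums l) :
    0 ≤ m ∧ m ≤ l.sum := by
  obtain ⟨s, hs, rfl⟩ := mem_subSums_s9.1 hm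
  exact ⟨List.sum_nonneg fun k hk => hl k (hs.subset hk), hs.sum_le_sum hl⟩

theorem eq_of_zsmul_eq_of_range {G : Type*} [AddCommGroup G] {a : G} {y d : ℤ}
    (h : y • a = d • a) (hy : addOrderOf a ≠ 0 → 0 ≤ y ∧ y < (addOrderOf a : ℤ))
    (hd : addOrderOf a ≠ 0 → 0 ≤ d ∧ d < (addOrderOf a : ℤ)) : y = d := by
  have hdvd : (addOrderOf a : ℤ) ∣ y - d := by
    rw [addOrderOf_dvd_iff_zsmul_eq_zero, sub_zsmul, h, add_neg_cancel]
  by_cases h0 : addOrderOf a = 0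
  · rw [h0, Nat.cast_zero, zero_dvd_iff] at hdvd
    omega
  · obtain ⟨hy0, hy1⟩ := hy h0
    obtain ⟨hd0, hd1⟩ := hd h0
    have := Int.eq_zero_of_abs_lt_dvd hdvd (abs_lt.2 ⟨by omega, by omega⟩)
    omega

/-- The terms of `l` are positive, its subsequence sums fill the interval `[0, σ(l)]`, and
`σ(l) < N` unless `N = 0`. -/
def FillsInterval (N : ℕ) (l : List ℤ) : Prop :=
  (∀ k ∈ l, 1 ≤ k) ∧ (∀ m, 0 ≤ m → m ≤ l.sum → m ∈ subSums l) ∧ (N ≠ 0 → l.sum < (N : ℤ))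

theorem FillsInterval.concat {G : Type*} [AddCommGroup G] {a : G} {l : List ℤ} {y : ℤ}
    (hl : FillsInterval (addOrderOf a) l) (hy1 : 1 ≤ y) (hy : y ≤ l.sum + 1)
    (hz : ∀ s : List ℤ, s.Sublist (l ++ [y]) → s ≠ [] → s.sum • a ≠ 0) :
    FillsInterval (addOrderOf a) (l ++ [y]) := by
  obtain ⟨hpos, hfill, -⟩ := hl
  have hfill' : ∀ m, 0 ≤ m → m ≤ (l ++ [y]).sum → m ∈ subSums (l ++ [y]) := by
    intro m hm0 hm
    simp only [List.sum_append, List.sum_singleton] at hm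
    rw [mem_subSums_s9]
    by_cases h : m ≤ l.sum
    · obtain ⟨s, hs, hsm⟩ := mem_subSums_s9.1 (hfill m hm0 h)
      exact ⟨s, hs.trans (List.sublist_append_left l [y]), hsm⟩
    · obtain ⟨s, hs, hsm⟩ := mem_subSums_s9.1 (hfill (m - y) (by omega) (by omega))
      exact ⟨s ++ [y], hs.append (List.Sublist.refl _), by simp [hsm]⟩
  refine ⟨?_, hfill', fun h0 => ?_⟩
  · simp only [List.mem_append, List.mem_singleton]
    rintro k (hk | rfl)
    exacts [hpos k hk, hy1]
  · by_contra hlt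
    obtain ⟨s, hs, hsm⟩ :=
      mem_subSums_s9.1 (hfill' (addOrderOf a) (Int.natCast_nonneg _) (not_lt.1 hlt))
    refine hz s hs ?_ ?_
    · rintro rfl
      simp only [List.sum_nil] at hsm
      omega
    · rw [hsm, natCast_zsmul, addOrderOf_nsmul_eq_zero]

theorem FillsInterval.next_mem_Icc {G : Type*} [AddCommGroup G] {a : G} {l : List ℤ} {y u v : ℤ}
    (hl : FillsInterval (addOrderOf a) l)
    (hz : ∀ s : List ℤ, s.Sublist (l ++ [y]) → s ≠ [] → s.sum • a ≠ 0)
    (hu : u ∈ subSums l) (hv : v ∈ subSums l) (huv : y • a = u • a - v • a)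
    (hy : addOrderOf a ≠ 0 → 0 ≤ y ∧ y < (addOrderOf a : ℤ)) :
    1 ≤ y ∧ y ≤ l.sum := by
  obtain ⟨hpos, hfill, hlt⟩ := hl
  have hnonneg : ∀ k ∈ l, 0 ≤ k := fun k hk => by have := hpos k hk; omega
  have hub := subSums_bounds hnonneg hu
  have hvb := subSums_bounds hnonneg hv
  have hd : 1 ≤ u - v := by
    by_contra hneg
    obtain ⟨s, hs, hsm⟩ := mem_subSums_s9.1 (hfill (v - u) (by omega) (by omega))
    refine hz (s ++ [y]) (hs.append (List.Sublist.refl _)) (by simp) ?_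
    rw [List.sum_append, List.sum_singleton, hsm, add_zsmul, huv, sub_zsmul]
    abel
  have hyd : y = u - v := by
    refine eq_of_zsmul_eq_of_range (a := a) ?_ hy fun h0 => ?_
    · rw [huv, sub_zsmul]
      abel
    · have := hlt h0
      omega
  omega

/-- **Claim.** Let `α = a :: t` be a connected sequence of elements of an abelian group
and let `ξ` be the associated integer sequence (so `a_k = x_k • a_1` for all `k`, with
`0 ≤ x_k < ord(a_1)` whenever `a_1` has finite order). If `α` is zero-sum-free, then all
terms of `ξ` are positive, `ξ` is strongly connected, and `σ(ξ) < ord(a_1)` in case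
`a_1` has finite order. -/
theorem associated_sequence {G : Type*} [AddCommGroup G] [DecidableEq G]
    (a : G) (t : List G) (x : List ℤ)
    (hconn : IsConnectedSeq (a :: t))
    (hlen : x.length = (a :: t).length)
    (hassoc : ∀ i : ℕ, ∀ h : i < x.length, (a :: t)[i]? = some (x.get ⟨i, h⟩ • a))
    (hrange : addOrderOf a ≠ 0 → ∀ k ∈ x, 0 ≤ k ∧ k < (addOrderOf a : ℤ))
    (hzsf : ZeroSumFree (a :: t)) :
    (∀ k ∈ x, 1 ≤ k) ∧
    IsStronglyConnected x ∧
    (addOrderOf a ≠ 0 → x.sum < (addOrderOf a : ℤ)) := by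
  have hmap : a :: t = x.map (fun k => k • a) := by
    refine List.ext_getElem? fun i => ?_
    by_cases h : i < x.length
    · rw [hassoc i h]
      simp [h]
    · rw [List.getElem?_eq_none (by omega), List.getElem?_eq_none (by simpa using h)]
  have hz : ∀ s : List ℤ, s.Sublist x → s ≠ [] → s.sum • a ≠ 0 := by
    intro s hs hne
    rw [← sum_map_zsmul]
    exact hzsf _ (hmap ▸ hs.map _) (by simpa using hne)
  have hzt : ∀ i (h : i < x.length), ∀ s : List ℤ, s.Sublist (x.take i ++ [x[i]]) → s ≠ [] →
      s.sum • a ≠ 0 := by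
    intro i h s hs
    rw [List.take_append_getElem] at hs
    exact hz s (hs.trans (List.take_sublist _ _))
  have hpos : 0 < x.length := by simp [hlen]
  have ha : a ≠ 0 := by
    simpa using hzsf [a] (by simp) (by simp)
  have hx0 : x[0] = 1 := by
    refine eq_of_zsmul_eq_of_range (a := a) ?_ (fun h0 => hrange h0 _ (List.getElem_mem _))
      fun h0 => ?_
    · simpa using (hassoc 0 hpos).symm
    · have h1 : addOrderOf a ≠ 1 := fun h => ha (AddMonoid.addOrderOf_eq_one_iff.1 h)
      omega
  have hnext : ∀ i (h : i < x.length), 0 < i → FillsInterval (addOrderOf a) (x.take i) →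
      1 ≤ x[i] ∧ x[i] ≤ (x.take i).sum := by
    intro i h hi hfill
    obtain ⟨g, hg, g', hg', hgg⟩ := hconn i (hlen ▸ h) hi
    rw [hmap, ← List.map_take] at hg hg'
    obtain ⟨u, hu, rfl⟩ := exists_of_mem_subSums_map_zsmul hg
    obtain ⟨v, hv, rfl⟩ := exists_of_mem_subSums_map_zsmul hg'
    refine hfill.next_mem_Icc (hzt i h) hu hv ?_ fun h0 => hrange h0 _ (List.getElem_mem _)
    have hi' := hassoc i h
    rw [List.getElem?_eq_getElem (hlen ▸ h), Option.some.injEq] at hi'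
    exact hi'.symm.trans hgg
  have hnil : FillsInterval (addOrderOf a) ([] : List ℤ) := by
    refine ⟨by simp, fun m h0 h1 => mem_subSums_s9.2 ⟨[], by simp, ?_⟩, fun h0 => ?_⟩
    · simp only [List.sum_nil] at h1 ⊢
      omega
    · simp only [List.sum_nil]
      omega
  have hfill : ∀ i ≤ x.length, FillsInterval (addOrderOf a) (x.take i) := by
    intro i
    induction i with
    | zero => exact fun _ => by simpa using hnil
    | succ i ih =>
      intro hi
      have hb : 1 ≤ x[i] ∧ x[i] ≤ (x.take i).sum + 1 := by
        rcases Nat.eq_zero_or_pos i with rfl | hi0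
        · simp [hx0]
        · have := hnext i hi hi0 (ih (by omega))
          omega
      rw [← List.take_append_getElem hi]
      exact (ih (by omega)).concat hb.1 hb.2 (hzt i hi)
  have hall := hfill x.length le_rfl
  rw [List.take_length] at hall
  refine ⟨hall.1, fun i h hi => ?_, hall.2.2⟩
  obtain ⟨h1, h2⟩ := hnext i h hi (hfill i h.le)
  exact (hfill i h.le).2.1 _ (by simpa using by omega) h2
end
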